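/- If a ≤ b and 0 ≤ π_{aa} ≤ π_{ab} ≤ π_b, then the two-item single-parameter mechanism with these interim probabilities and payments is Bayesian incentive compatible and individually rational: for all true types v ∈ {a,b}^2 and all reports r ∈ {a,b}^2, u(v,v) ≥ u(v,r), and u(v,v) ≥ 0. -/

import Mathlib

/-!
The two-item single-parameter mechanism.  A type/report is a pair `r : Bool × Bool`,
where `true` means the high value `b` and `false` the low value `a` for the
corresponding item.
-/

noncomputable section

/-- Interim allocation probability for item 1 under report `r`. -/
def alloc1 (πb πab πaa : ℝ) (r : Bool × Bool) : ℝ :=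
  if r.1 then πb else if r.2 then πab else πaa

/-- Interim allocation probability for item 2 under report `r`. -/
def alloc2 (πb πab πaa : ℝ) (r : Bool × Bool) : ℝ :=
  if r.2 then πb else if r.1 then πab else πaa

/-- Interim payment under report `r`:
`p(b,b) = 2b·π_b − (b−a)(π_{ab}+π_{aa})`,
`p(b,a) = p(a,b) = b·π_b + a·π_{ab} − (b−a)·π_{aa}`,
`p(a,a) = 2a·π_{aa}`. -/
def payment (a b πb πab πaa : ℝ) (r : Bool × Bool) : ℝ :=
  match r with
  | (true, true) => 2 * b * πb - (b - a) * (πab + πaa)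
  | (true, false) => b * πb + a * πab - (b - a) * πaa
  | (false, true) => b * πb + a * πab - (b - a) * πaa
  | (false, false) => 2 * a * πaa

/-- Utility of true type `v` reporting `r`. -/
def util (a b πb πab πaa : ℝ) (v r : Bool × Bool) : ℝ :=
  (if v.1 then b else a) * alloc1 πb πab πaa r +
  (if v.2 then b else a) * alloc2 πb πab πaa r - payment a b πb πab πaa r

/-- If `a ≤ b` and `0 ≤ π_{aa} ≤ π_{ab} ≤ π_b`, the two-item single-parameter
mechanism is Bayesian incentive compatible and individually rational. -/
theorem twoItem_BIC_IR (a b πb πab πaa : ℝ) (hab : a ≤ b)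
    (h0 : 0 ≤ πaa) (h1 : πaa ≤ πab) (h2 : πab ≤ πb) :
    ∀ v r : Bool × Bool,
      util a b πb πab πaa v v ≥ util a b πb πab πaa v r ∧
      util a b πb πab πaa v v ≥ 0 := by
  have hd : 0 ≤ b - a := sub_nonneg.2 hab
  have h0' := mul_nonneg hd h0
  have h1' := mul_nonneg hd (sub_nonneg.2 h1)
  have h2' := mul_nonneg hd (sub_nonneg.2 h2)
  rintro ⟨_ | _, _ | _⟩ ⟨_ | _, _ | _⟩ <;>
    constructor <;>
    simp only [util, alloc1, alloc2, payment, if_true, if_false, Bool.false_eq_true] <;>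
    linarith
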